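/- arXiv:2003.02246 — 2 statements merged into one kernel-verified Lean document; each statement's English description precedes it below -/
import Mathlib

section
/- Let q = 2^n with n ≥ 5, let a ∈ F_q with a ≠ 0, let b ∈ {0, 1} ⊆ F_q, and let r ∈ F_{q^2} with r ∉ F_q. Then the map from F_q to F_{q^2} sending x to a·x^2 + b·x + 1/(x − r) + 1/(x − r^q) is not injective. -/
open Finset

/-- The sum over a finite field `F` of the `m`-th powers of the translates of `r`. -/
theorem sum_algebraMap_add_pow_eq_zero {F K : Type*} [Field F] [Fintype F] [Field K] [Algebra F K]
    (r : K) {m : ℕ} (hm : m < Fintype.card F - 1) :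
    ∑ x : F, (algebraMap F K x + r) ^ m = 0 := by
  simp_rw [add_pow]
  rw [sum_comm]
  refine sum_eq_zero fun i hi => ?_
  have hi' : i < Fintype.card F - 1 := (Nat.lt_succ_iff.1 (mem_range.1 hi)).trans_lt hm
  simp_rw [← sum_mul, ← map_pow, ← map_sum, FiniteField.sum_pow_lt_card_sub_one F i hi', map_zero,
    zero_mul]

theorem sum_algebraMap_add_pow_card_sub_one {F K : Type*} [Field F] [Fintype F] [Field K]
    [Algebra F K] (r : K) :
    ∑ x : F, (algebraMap F K x + r) ^ (Fintype.card F - 1) = -1 := by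
  classical
  simp_rw [add_pow]
  rw [sum_comm, sum_range_succ, sum_eq_zero]
  · have h : ∀ x : F, x ^ (Fintype.card F - 1) = 1 - if x = 0 then 1 else 0 := fun x => by
      have := Fintype.one_lt_card (α := F)
      split_ifs with hx
      · rw [hx, zero_pow (by omega), sub_self]
      · rw [FiniteField.pow_card_sub_one_eq_one x hx, sub_zero]
    have h' : ∑ x : F, x ^ (Fintype.card F - 1) = -1 := by
      simp_rw [h]
      simp
    simp [← map_pow, ← map_sum, h']
  · intro i hi
    simp_rw [← sum_mul, ← map_pow, ← map_sum,
      FiniteField.sum_pow_lt_card_sub_one F i (mem_range.1 hi), map_zero, zero_mul]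

theorem add_pow_card_of_charTwo {F K : Type*} [Field F] [Fintype F] [Field K] [Algebra F K]
    [CharP K 2] (u v : K) :
    (u + v) ^ Fintype.card F = u ^ Fintype.card F + v ^ Fintype.card F := by
  obtain ⟨p, hp⟩ := CharP.exists F
  obtain rfl : p = 2 :=
    CharP.eq K (charP_of_injective_algebraMap (algebraMap F K).injective p) ‹CharP K 2›
  obtain ⟨n, -, hn⟩ := FiniteField.card F 2
  rw [hn, add_pow_char_pow]

/-- If `r ^ q = r + 1` in characteristic two, the sum of `(x + r)⁻ʲ` over `x ∈ 𝔽_q` is one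
for `1 ≤ j ≤ q`. -/
theorem sum_inv_algebraMap_add_pow {F K : Type*} [Field F] [Fintype F] [Field K]
    [Algebra F K] [CharP K 2] {r : K} (hr : r ^ Fintype.card F = r + 1) {j : ℕ} (hj : 1 ≤ j)
    (hjq : j ≤ Fintype.card F) :
    ∑ x : F, (algebraMap F K x + r)⁻¹ ^ j = 1 := by
  have h2 : (2 : K) = 0 := CharTwo.two_eq_zero
  have hpow (x : F) : (algebraMap F K x + r) ^ Fintype.card F = algebraMap F K x + r + 1 := by
    rw [add_pow_card_of_charTwo, hr, ← map_pow, FiniteField.pow_card, add_assoc]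
  have hne (x : F) : algebraMap F K x + r ≠ 0 := fun h => by
    have := hpow x
    rw [h, zero_pow Fintype.card_ne_zero] at this
    simp at this
  have hrec {j : ℕ} (hj : j + 1 ≤ Fintype.card F) (x : F) : (algebraMap F K x + r)⁻¹ ^ (j + 1)
      = (algebraMap F K x + r) ^ (Fintype.card F - (j + 1)) + (algebraMap F K x + r)⁻¹ ^ j := by
    have h1 := hpow x
    rw [← Nat.sub_add_cancel hj, pow_add] at h1
    have h0 := mul_inv_cancel₀ (hne x)
    generalize algebraMap F K x + r = w at h0 h1 ⊢
    generalize w⁻¹ = v at h0 ⊢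
    have hw : w ^ (j + 1) * v ^ (j + 1) = 1 := by rw [← mul_pow, h0, one_pow]
    linear_combination -v ^ (j + 1) * h1 + w ^ (Fintype.card F - (j + 1)) * hw - v ^ j * h0
      - v ^ j * h2
  induction j, hj using Nat.le_induction with
  | base =>
    have hcard : (Fintype.card F : K) = 0 := by
      rw [← map_natCast (algebraMap F K), FiniteField.cast_card_eq_zero, map_zero]
    simp_rw [hrec (j := 0) hjq, sum_add_distrib, zero_add, pow_zero,
      sum_algebraMap_add_pow_card_sub_one]
    simp [hcard, CharTwo.neg_eq]
  | succ j hj ih =>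
    simp_rw [hrec hjq, sum_add_distrib, ih (by omega)]
    rw [sum_algebraMap_add_pow_eq_zero r (by omega), zero_add]

theorem mem_range_algebraMap_of_pow_card_eq {F K : Type*} [Field F] [Fintype F] [Field K]
    [Algebra F K] {y : K} (hy : y ^ Fintype.card F = y) : y ∈ Set.range (algebraMap F K) := by
  classical
  by_contra hmem
  have hq := Fintype.one_lt_card (α := F)
  let p : Polynomial K := Polynomial.X ^ Fintype.card F - Polynomial.X
  have hp : p ≠ 0 := FiniteField.X_pow_card_sub_X_ne_zero K hq
  have hsub : (insert y (univ.image (algebraMap F K))).val ⊆ p.roots := by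
    intro z hz
    rw [Polynomial.mem_roots hp, Polynomial.IsRoot.def]
    rcases mem_insert.1 hz with rfl | hz
    · simp [p, hy]
    · obtain ⟨x, -, rfl⟩ := mem_image.1 hz
      simp [p, ← map_pow, FiniteField.pow_card]
  have hle := Polynomial.card_le_degree_of_subset_roots hsub
  rw [FiniteField.X_pow_card_sub_X_natDegree_eq K hq, card_insert_of_notMem (by simpa using hmem),
    card_image_of_injective _ (algebraMap F K).injective, card_univ] at hle
  omega

section ArtinSchreier

variable {F K : Type*} [Field F] [Field K] [Algebra F K]

theorem algebraMap_add_ne_zero_of_pow_card_eq_add_one [Fintype F] {r : K}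
    (hr : r ^ Fintype.card F = r + 1) (x : F) : algebraMap F K x + r ≠ 0 := fun h => by
  have h1 : r = algebraMap F K (-x) := by rw [map_neg]; linear_combination h
  rw [h1, ← map_pow, FiniteField.pow_card] at hr
  simp at hr

variable [CharP K 2]

/-- For `r ^ q = r + 1`, the sums of `(x + r)⁻ᵃ (x + r + 1)⁻ᵇ` over `x ∈ 𝔽_q` are binomial
coefficients modulo two. -/
theorem sum_inv_pow_mul_inv_pow [Fintype F] {r : K} (hr : r ^ Fintype.card F = r + 1) {a b : ℕ}
    (hab : a + b ≠ 0) (ha : a ≤ Fintype.card F) (hb : b ≤ Fintype.card F) :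
    ∑ x : F, (algebraMap F K x + r)⁻¹ ^ a * (algebraMap F K x + (r + 1))⁻¹ ^ b
      = ((a + b).choose a : K) := by
  have hr' : (r + 1) ^ Fintype.card F = r + 1 + 1 := by
    rw [add_pow_card_of_charTwo (F := F), hr, one_pow]
  induction a generalizing b with
  | zero => simpa using sum_inv_algebraMap_add_pow hr' (j := b) (by omega) hb
  | succ a iha =>
    induction b with
    | zero => simpa using sum_inv_algebraMap_add_pow hr (j := a + 1) (by omega) ha
    | succ b ihb =>
      have h (x : F) :
          (algebraMap F K x + r)⁻¹ ^ (a + 1) * (algebraMap F K x + (r + 1))⁻¹ ^ (b + 1)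
          = (algebraMap F K x + r)⁻¹ ^ a * (algebraMap F K x + (r + 1))⁻¹ ^ (b + 1)
            + (algebraMap F K x + r)⁻¹ ^ (a + 1) * (algebraMap F K x + (r + 1))⁻¹ ^ b := by
        have h0 := mul_inv_cancel₀ (algebraMap_add_ne_zero_of_pow_card_eq_add_one hr x)
        have h1 := mul_inv_cancel₀ (algebraMap_add_ne_zero_of_pow_card_eq_add_one hr' x)
        rw [← add_assoc] at h1 ⊢
        have h2 : (2 : K) = 0 := CharTwo.two_eq_zero
        generalize algebraMap F K x + r = w at h0 h1 ⊢
        generalize w⁻¹ = u at h0 ⊢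
        generalize (w + 1)⁻¹ = v at h1 ⊢
        have huv : u * v = u + v := by linear_combination u * h1 - v * h0 - v * h2
        linear_combination u ^ a * v ^ b * huv
      simp_rw [h, sum_add_distrib]
      rw [iha (by omega) (by omega) hb, ihb (by omega) (by omega),
        show a + 1 + (b + 1) = a + b + 1 + 1 by ring, Nat.choose_succ_succ]
      push_cast
      congr 3
      ring

theorem algebraMap_inv_sq_add_self {r : K} {N : F} (hN : algebraMap F K N = r ^ 2 + r) (x : F) :
    algebraMap F K (x ^ 2 + x + N)⁻¹
      = (algebraMap F K x + r)⁻¹ * (algebraMap F K x + (r + 1))⁻¹ := by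
  rw [map_inv₀, ← mul_inv, map_add, map_add, map_pow, hN]
  congr 1
  linear_combination -algebraMap F K x * r * (CharTwo.two_eq_zero : (2 : K) = 0)

theorem sum_inv_sq_add_self_pow [Fintype F] {r : K} (hr : r ^ Fintype.card F = r + 1) {N : F}
    (hN : algebraMap F K N = r ^ 2 + r) {j : ℕ} (hj : 1 ≤ j) (hjq : j ≤ Fintype.card F) :
    ∑ x : F, (x ^ 2 + x + N)⁻¹ ^ j = 0 := by
  apply (algebraMap F K).injective
  simp_rw [map_sum, map_pow, algebraMap_inv_sq_add_self hN, mul_pow]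
  rw [sum_inv_pow_mul_inv_pow hr (by omega) hjq hjq, ← two_mul, ← Nat.centralBinom_eq_two_mul_choose,
    map_zero, CharP.cast_eq_zero_iff K 2]
  exact Nat.two_dvd_centralBinom_of_one_le hj

theorem sum_mul_inv_sq_add_self_pow [Fintype F] {r : K} (hr : r ^ Fintype.card F = r + 1) {N : F}
    (hN : algebraMap F K N = r ^ 2 + r) {j : ℕ} (hjq : j + 1 ≤ Fintype.card F) :
    ∑ x : F, x * (x ^ 2 + x + N)⁻¹ ^ (j + 1) = ((2 * j + 1).choose j : F) := by
  apply (algebraMap F K).injective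
  have h (x : F) : algebraMap F K (x * (x ^ 2 + x + N)⁻¹ ^ (j + 1))
      = (algebraMap F K x + r)⁻¹ ^ j * (algebraMap F K x + (r + 1))⁻¹ ^ (j + 1)
        - r * algebraMap F K ((x ^ 2 + x + N)⁻¹ ^ (j + 1)) := by
    rw [map_mul, map_pow, algebraMap_inv_sq_add_self hN]
    have h0 := mul_inv_cancel₀ (algebraMap_add_ne_zero_of_pow_card_eq_add_one hr x)
    generalize (algebraMap F K x + (r + 1))⁻¹ = v
    generalize (algebraMap F K x + r)⁻¹ = u at h0 ⊢
    linear_combination u ^ j * v ^ (j + 1) * h0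
  simp_rw [map_sum, h, sum_sub_distrib, ← mul_sum, ← map_sum,
    sum_inv_sq_add_self_pow hr hN (by omega : 1 ≤ j + 1) hjq]
  rw [sum_inv_pow_mul_inv_pow hr (by omega) (by omega) hjq, ← add_assoc, ← two_mul]
  simp

end ArtinSchreier

section PowerSums

variable {F : Type*} [Field F] [Fintype F]

/-- The moments `∑ xⁱ (x² + x + N)⁻ʲ` over a finite field. -/
def moment (N : F) (i j : ℕ) : F := ∑ x : F, x ^ i * (x ^ 2 + x + N)⁻¹ ^ j

theorem moment_add_two_add_one [CharP F 2] {N : F} (hD : ∀ x : F, x ^ 2 + x + N ≠ 0) (i j : ℕ) :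
    moment N (i + 2) (j + 1)
      = moment N i j + moment N (i + 1) (j + 1) + N * moment N i (j + 1) := by
  simp only [moment]
  rw [mul_sum, ← sum_add_distrib, ← sum_add_distrib]
  refine sum_congr rfl fun x _ => ?_
  have h := mul_inv_cancel₀ (hD x)
  have h2 : (2 : F) = 0 := CharTwo.two_eq_zero
  generalize (x ^ 2 + x + N)⁻¹ = v at h ⊢
  linear_combination x ^ i * v ^ j * h - (x ^ (i + 1) * v ^ (j + 1) + N * x ^ i * v ^ (j + 1)) * h2

variable {N : F} (hcard : 32 ≤ Fintype.card F) (hD : ∀ x : F, x ^ 2 + x + N ≠ 0)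
  (hzero : ∀ j, j + 1 ≤ Fintype.card F → moment N 0 (j + 1) = 0)
  (hone : ∀ j, j + 1 ≤ Fintype.card F → moment N 1 (j + 1) = ((2 * j + 1).choose j : F))

include hcard in
theorem moment_zero_right {i : ℕ} (hi : i < 31) : moment N i 0 = 0 := by
  simpa [moment] using FiniteField.sum_pow_lt_card_sub_one F i (by omega)

include hcard hD hzero hone

theorem sum_pow_three_eq [CharP F 2] (A B : F) :
    ∑ x : F, (A * x ^ 2 + B * x + (x ^ 2 + x + N)⁻¹) ^ 3 = A + B + A ^ 2 + B ^ 2 := by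
  have hx (x : F) : (A * x ^ 2 + B * x + (x ^ 2 + x + N)⁻¹) ^ 3
      = A ^ 3 * (x ^ 6 * (x ^ 2 + x + N)⁻¹ ^ 0) + A ^ 2 * B * (x ^ 5 * (x ^ 2 + x + N)⁻¹ ^ 0)
      + A ^ 2 * (x ^ 4 * (x ^ 2 + x + N)⁻¹ ^ 1) + A * B ^ 2 * (x ^ 4 * (x ^ 2 + x + N)⁻¹ ^ 0)
      + B ^ 3 * (x ^ 3 * (x ^ 2 + x + N)⁻¹ ^ 0) + B ^ 2 * (x ^ 2 * (x ^ 2 + x + N)⁻¹ ^ 1)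
      + A * (x ^ 2 * (x ^ 2 + x + N)⁻¹ ^ 2) + B * (x ^ 1 * (x ^ 2 + x + N)⁻¹ ^ 2)
      + (x ^ 0 * (x ^ 2 + x + N)⁻¹ ^ 3) := by
    have hs (u v : F) : (u + v) ^ 2 = u ^ 2 + v ^ 2 := CharTwo.add_sq u v
    generalize (x ^ 2 + x + N)⁻¹ = v
    rw [show ∀ u : F, u ^ 3 = u * u ^ 2 from fun u => by ring]
    simp only [hs]
    ring
  have hsum : ∑ x : F, (A * x ^ 2 + B * x + (x ^ 2 + x + N)⁻¹) ^ 3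
      = A ^ 3 * moment N 6 0 + A ^ 2 * B * moment N 5 0 + A ^ 2 * moment N 4 1
      + A * B ^ 2 * moment N 4 0 + B ^ 3 * moment N 3 0 + B ^ 2 * moment N 2 1
      + A * moment N 2 2 + B * moment N 1 2 + moment N 0 3 := by
    simp only [hx, sum_add_distrib, ← mul_sum, mul_assoc, moment]
  have hz (j : ℕ) (hj : j ≤ 12) : moment N 0 (j + 1) = 0 := hzero j (by omega)
  have ho (j : ℕ) (hj : j ≤ 12) : moment N 1 (j + 1) = ((2 * j + 1).choose j : F) :=
    hone j (by omega)
  have hr (i : ℕ) (hi : i < 31) : moment N i 0 = 0 := moment_zero_right hcard hi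
  rw [hsum]
  simp [moment_add_two_add_one hD, hr, hz, ho, Nat.choose]
  ring_nf
  reduce_mod_char!

theorem sum_pow_seven_eq [CharP F 2] {A B : F} (hAB : A = B + 1) :
    ∑ x : F, (A * x ^ 2 + B * x + (x ^ 2 + x + N)⁻¹) ^ 7 = B ^ 2 + B := by
  have hx (x : F) : (A * x ^ 2 + B * x + (x ^ 2 + x + N)⁻¹) ^ 7
      = A ^ 7 * (x ^ 14 * (x ^ 2 + x + N)⁻¹ ^ 0) + A ^ 6 * B * (x ^ 13 * (x ^ 2 + x + N)⁻¹ ^ 0)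
      + A ^ 6 * (x ^ 12 * (x ^ 2 + x + N)⁻¹ ^ 1)
      + A ^ 5 * B ^ 2 * (x ^ 12 * (x ^ 2 + x + N)⁻¹ ^ 0)
      + A ^ 4 * B ^ 3 * (x ^ 11 * (x ^ 2 + x + N)⁻¹ ^ 0)
      + A ^ 4 * B ^ 2 * (x ^ 10 * (x ^ 2 + x + N)⁻¹ ^ 1)
      + A ^ 5 * (x ^ 10 * (x ^ 2 + x + N)⁻¹ ^ 2) + A ^ 4 * B * (x ^ 9 * (x ^ 2 + x + N)⁻¹ ^ 2)
      + A ^ 4 * (x ^ 8 * (x ^ 2 + x + N)⁻¹ ^ 3)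
      + A ^ 3 * B ^ 4 * (x ^ 10 * (x ^ 2 + x + N)⁻¹ ^ 0)
      + A ^ 2 * B ^ 5 * (x ^ 9 * (x ^ 2 + x + N)⁻¹ ^ 0)
      + A ^ 2 * B ^ 4 * (x ^ 8 * (x ^ 2 + x + N)⁻¹ ^ 1)
      + A * B ^ 6 * (x ^ 8 * (x ^ 2 + x + N)⁻¹ ^ 0) + B ^ 7 * (x ^ 7 * (x ^ 2 + x + N)⁻¹ ^ 0)
      + B ^ 6 * (x ^ 6 * (x ^ 2 + x + N)⁻¹ ^ 1) + A * B ^ 4 * (x ^ 6 * (x ^ 2 + x + N)⁻¹ ^ 2)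
      + B ^ 5 * (x ^ 5 * (x ^ 2 + x + N)⁻¹ ^ 2) + B ^ 4 * (x ^ 4 * (x ^ 2 + x + N)⁻¹ ^ 3)
      + A ^ 3 * (x ^ 6 * (x ^ 2 + x + N)⁻¹ ^ 4) + A ^ 2 * B * (x ^ 5 * (x ^ 2 + x + N)⁻¹ ^ 4)
      + A ^ 2 * (x ^ 4 * (x ^ 2 + x + N)⁻¹ ^ 5) + A * B ^ 2 * (x ^ 4 * (x ^ 2 + x + N)⁻¹ ^ 4)
      + B ^ 3 * (x ^ 3 * (x ^ 2 + x + N)⁻¹ ^ 4) + B ^ 2 * (x ^ 2 * (x ^ 2 + x + N)⁻¹ ^ 5)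
      + A * (x ^ 2 * (x ^ 2 + x + N)⁻¹ ^ 6) + B * (x ^ 1 * (x ^ 2 + x + N)⁻¹ ^ 6)
      + (x ^ 0 * (x ^ 2 + x + N)⁻¹ ^ 7) := by
    have hs (u v : F) : (u + v) ^ 2 = u ^ 2 + v ^ 2 := CharTwo.add_sq u v
    generalize (x ^ 2 + x + N)⁻¹ = v
    rw [show ∀ u : F, u ^ 7 = u * u ^ 2 * (u ^ 2) ^ 2 from fun u => by ring]
    simp only [hs]
    ring
  have hsum : ∑ x : F, (A * x ^ 2 + B * x + (x ^ 2 + x + N)⁻¹) ^ 7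
      = A ^ 7 * moment N 14 0 + A ^ 6 * B * moment N 13 0 + A ^ 6 * moment N 12 1
      + A ^ 5 * B ^ 2 * moment N 12 0 + A ^ 4 * B ^ 3 * moment N 11 0
      + A ^ 4 * B ^ 2 * moment N 10 1 + A ^ 5 * moment N 10 2 + A ^ 4 * B * moment N 9 2
      + A ^ 4 * moment N 8 3 + A ^ 3 * B ^ 4 * moment N 10 0 + A ^ 2 * B ^ 5 * moment N 9 0
      + A ^ 2 * B ^ 4 * moment N 8 1 + A * B ^ 6 * moment N 8 0 + B ^ 7 * moment N 7 0
      + B ^ 6 * moment N 6 1 + A * B ^ 4 * moment N 6 2 + B ^ 5 * moment N 5 2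
      + B ^ 4 * moment N 4 3 + A ^ 3 * moment N 6 4 + A ^ 2 * B * moment N 5 4
      + A ^ 2 * moment N 4 5 + A * B ^ 2 * moment N 4 4 + B ^ 3 * moment N 3 4
      + B ^ 2 * moment N 2 5 + A * moment N 2 6 + B * moment N 1 6 + moment N 0 7 := by
    simp only [hx, sum_add_distrib, ← mul_sum, mul_assoc, moment]
  have hz (j : ℕ) (hj : j ≤ 12) : moment N 0 (j + 1) = 0 := hzero j (by omega)
  have ho (j : ℕ) (hj : j ≤ 12) : moment N 1 (j + 1) = ((2 * j + 1).choose j : F) :=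
    hone j (by omega)
  have hr (i : ℕ) (hi : i < 31) : moment N i 0 = 0 := moment_zero_right hcard hi
  rw [hsum]
  subst hAB
  simp [moment_add_two_add_one hD, hr, hz, ho, Nat.choose]
  ring_nf
  reduce_mod_char!

set_option maxHeartbeats 800000 in
theorem sum_pow_eleven_eq [CharP F 2] :
    ∑ x : F, (x ^ 2 + (x ^ 2 + x + N)⁻¹) ^ 11 = 1 := by
  have hx (x : F) : (x ^ 2 + (x ^ 2 + x + N)⁻¹) ^ 11
      = (x ^ 22 * (x ^ 2 + x + N)⁻¹ ^ 0) + (x ^ 20 * (x ^ 2 + x + N)⁻¹ ^ 1)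
      + (x ^ 18 * (x ^ 2 + x + N)⁻¹ ^ 2) + (x ^ 16 * (x ^ 2 + x + N)⁻¹ ^ 3)
      + (x ^ 6 * (x ^ 2 + x + N)⁻¹ ^ 8) + (x ^ 4 * (x ^ 2 + x + N)⁻¹ ^ 9)
      + (x ^ 2 * (x ^ 2 + x + N)⁻¹ ^ 10) + (x ^ 0 * (x ^ 2 + x + N)⁻¹ ^ 11) := by
    have hs (u v : F) : (u + v) ^ 2 = u ^ 2 + v ^ 2 := CharTwo.add_sq u v
    generalize (x ^ 2 + x + N)⁻¹ = v
    rw [show ∀ u : F, u ^ 11 = u * u ^ 2 * ((u ^ 2) ^ 2) ^ 2 from fun u => by ring]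
    simp only [hs]
    ring
  have hsum : ∑ x : F, (x ^ 2 + (x ^ 2 + x + N)⁻¹) ^ 11
      = moment N 22 0 + moment N 20 1 + moment N 18 2 + moment N 16 3 + moment N 6 8 + moment N 4 9
      + moment N 2 10 + moment N 0 11 := by
    simp only [hx, sum_add_distrib, moment]
  have hz (j : ℕ) (hj : j ≤ 12) : moment N 0 (j + 1) = 0 := hzero j (by omega)
  have ho (j : ℕ) (hj : j ≤ 12) : moment N 1 (j + 1) = ((2 * j + 1).choose j : F) :=
    hone j (by omega)
  have hr (i : ℕ) (hi : i < 31) : moment N i 0 = 0 := moment_zero_right hcard hi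
  rw [hsum]
  simp [moment_add_two_add_one hD, hr, hz, ho, Nat.choose]
  ring_nf
  reduce_mod_char!

end PowerSums

theorem sum_pow_eq_zero_of_injective {F : Type*} [Field F] [Fintype F] {f : F → F}
    (hf : Function.Injective f) {k : ℕ} (hk : k < Fintype.card F - 1) : ∑ x : F, f x ^ k = 0 := by
  rw [(Finite.injective_iff_bijective.1 hf).sum_comp (fun y => y ^ k)]
  exact FiniteField.sum_pow_lt_card_sub_one F k hk

/-- If `A ≠ 0` and `r ^ q = r + 1`, then `A x² + B x + 1 / ((x + r) (x + r + 1))` is not injective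
on `𝔽_q`: otherwise its power sums of exponents 3, 7 and 11 would all vanish. -/
theorem not_injective_mul_sq_add_mul_add_inv {F K : Type*} [Field F] [Fintype F] [Field K]
    [Algebra F K] [CharP F 2] [CharP K 2] (hcard : 32 ≤ Fintype.card F) {r : K}
    (hr : r ^ Fintype.card F = r + 1) {N : F} (hN : algebraMap F K N = r ^ 2 + r) {A B : F}
    (hA : A ≠ 0) :
    ¬ Function.Injective fun x : F => A * x ^ 2 + B * x + (x ^ 2 + x + N)⁻¹ := by
  intro hf
  have h2 : (2 : F) = 0 := CharTwo.two_eq_zero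
  have hD (x : F) : x ^ 2 + x + N ≠ 0 := fun h => by
    have h0 := algebraMap_add_ne_zero_of_pow_card_eq_add_one hr x
    have h1 := algebraMap_add_ne_zero_of_pow_card_eq_add_one hr (x + 1)
    have h3 := congrArg (algebraMap F K) h
    simp only [map_add, map_pow, hN, map_zero, map_one] at h1 h3
    refine mul_ne_zero h0 h1 ?_
    linear_combination h3 + algebraMap F K x * r * (CharTwo.two_eq_zero : (2 : K) = 0)
  have hzero (j : ℕ) (hj : j + 1 ≤ Fintype.card F) : moment N 0 (j + 1) = 0 := by
    simpa [moment] using sum_inv_sq_add_self_pow hr hN (Nat.le_add_left 1 j) hj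
  have hone (j : ℕ) (hj : j + 1 ≤ Fintype.card F) :
      moment N 1 (j + 1) = ((2 * j + 1).choose j : F) := by
    simpa [moment] using sum_mul_inv_sq_add_self_pow hr hN hj
  have h3 := sum_pow_three_eq hcard hD hzero hone A B
  rw [sum_pow_eq_zero_of_injective hf (by omega)] at h3
  have hAB : (A + B) * (A + B + 1) = 0 := by linear_combination -h3 + A * B * h2
  rcases mul_eq_zero.1 hAB with h | h
  · have h01 : (0 : F) = 1 := hf (by
      have hN1 : (1 : F) ^ 2 + 1 + N = 0 ^ 2 + 0 + N := by linear_combination h2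
      simp only [hN1]
      linear_combination -h)
    exact zero_ne_one h01
  · have hAB' : A = B + 1 := by linear_combination h - (B + 1) * h2
    have h7 := sum_pow_seven_eq hcard hD hzero hone hAB'
    rw [sum_pow_eq_zero_of_injective hf (by omega)] at h7
    have hB : B = 0 := by
      have : A * B = 0 := by rw [hAB']; linear_combination -h7
      exact (mul_eq_zero.1 this).resolve_left hA
    have h11 := sum_pow_eleven_eq hcard hD hzero hone
    subst hB
    simp only [hAB', zero_add, one_mul, zero_mul, add_zero] at hf
    rw [sum_pow_eq_zero_of_injective hf (by omega)] at h11
    exact zero_ne_one h11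


/-- For `q = 2^n`, `n ≥ 5`, `a ∈ F_q*`, `b ∈ {0,1}`, `r ∈ F_{q²} \ F_q`, the map
`x ↦ a·x² + b·x + 1/(x - r) + 1/(x - r^q)` is not injective on `F_q`. -/
theorem stmt_4 (n : ℕ) (hn : 5 ≤ n) (q : ℕ) (hq : q = 2 ^ n)
    (F K : Type*) [Field F] [Fintype F] [Field K] [Fintype K] [Algebra F K]
    (hF : Fintype.card F = q) (hK : Fintype.card K = q ^ 2)
    (a : F) (ha : a ≠ 0) (b : F) (hb : b = 0 ∨ b = 1)
    (r : K) (hr : r ∉ Set.range (algebraMap F K)) :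
    ¬ Function.Injective fun x : F =>
      algebraMap F K (a * x ^ 2 + b * x) + (algebraMap F K x - r)⁻¹
        + (algebraMap F K x - r ^ q)⁻¹ := by
  intro hf
  have hcard : 32 ≤ Fintype.card F := by
    rw [hF, hq]
    exact Nat.pow_le_pow_right (n := 2) (by norm_num) hn
  have : CharP F 2 := by
    obtain ⟨p, hp⟩ := CharP.exists F
    obtain ⟨m, hpp, hm⟩ := FiniteField.card F p
    have hdvd : p ∣ 2 ^ n := by
      rw [← hq, ← hF, hm]
      exact dvd_pow_self p m.ne_zero
    obtain rfl : p = 2 := (Nat.prime_dvd_prime_iff_eq hpp Nat.prime_two).1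
      (hpp.dvd_of_dvd_pow hdvd)
    exact hp
  have : CharP K 2 := charP_of_injective_algebraMap (algebraMap F K).injective 2
  have h2 : (2 : K) = 0 := CharTwo.two_eq_zero
  have hadd (u v : K) : (u + v) ^ q = u ^ q + v ^ q := by rw [hq, add_pow_char_pow]
  have hrq : (r ^ q) ^ q = r := by rw [← pow_mul, ← sq, ← hK, FiniteField.pow_card]
  obtain ⟨t, ht⟩ : r + r ^ q ∈ Set.range (algebraMap F K) := by
    apply mem_range_algebraMap_of_pow_card_eq
    rw [hF, hadd, hrq, add_comm]
  have hrq' : r ^ q = r + algebraMap F K t := by linear_combination -ht - r * h2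
  have ht0 : t ≠ 0 := by
    rintro rfl
    rw [map_zero, add_zero, ← hF] at hrq'
    exact hr (mem_range_algebraMap_of_pow_card_eq hrq')
  have hT0 : algebraMap F K t ≠ 0 := by simpa using ht0
  have hTq : algebraMap F K t ^ q = algebraMap F K t := by
    rw [← map_pow, ← hF, FiniteField.pow_card]
  have hs : (r / algebraMap F K t) ^ Fintype.card F = r / algebraMap F K t + 1 := by
    rw [hF, div_pow, hTq, hrq', add_div, div_self hT0]
  obtain ⟨N, hN⟩ : (r / algebraMap F K t) ^ 2 + r / algebraMap F K t
      ∈ Set.range (algebraMap F K) := by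
    apply mem_range_algebraMap_of_pow_card_eq
    rw [hF] at hs ⊢
    rw [hadd, ← pow_mul, mul_comm, pow_mul, hs]
    linear_combination (r / algebraMap F K t + 1) * h2
  refine not_injective_mul_sq_add_mul_add_inv (A := a * t ^ 3) (B := b * t ^ 2) hcard hs hN
    (mul_ne_zero ha (pow_ne_zero 3 ht0)) fun x y hxy => ?_
  have hscale (x : F) : algebraMap F K (a * t ^ 3 * x ^ 2 + b * t ^ 2 * x + (x ^ 2 + x + N)⁻¹)
      = algebraMap F K t * (algebraMap F K (a * (t * x) ^ 2 + b * (t * x))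
        + (algebraMap F K (t * x) - r)⁻¹ + (algebraMap F K (t * x) - r ^ q)⁻¹) := by
    have h0 := algebraMap_add_ne_zero_of_pow_card_eq_add_one hs x
    have h1 := algebraMap_add_ne_zero_of_pow_card_eq_add_one hs (x + 1)
    rw [map_add _ _ (x ^ 2 + x + N)⁻¹, algebraMap_inv_sq_add_self hN, hrq']
    have hr' : r = algebraMap F K t * (r / algebraMap F K t) := by field_simp
    generalize r / algebraMap F K t = s at h0 h1 hr'
    rw [hr']
    simp only [map_add, map_mul, map_pow, map_one, CharTwo.sub_eq_add] at h1 ⊢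
    rw [add_assoc, add_comm 1 s] at h1
    generalize algebraMap F K t = T at hT0 ⊢
    generalize algebraMap F K x = X at h0 h1 ⊢
    rw [show T * X + (T * s + T) = T * (X + (s + 1)) by ring, ← mul_add, mul_inv, mul_inv]
    have h0' := mul_inv_cancel₀ h0
    have h1' := mul_inv_cancel₀ h1
    have hT' := mul_inv_cancel₀ hT0
    generalize (X + s)⁻¹ = u at h0' ⊢
    generalize (X + (s + 1))⁻¹ = v at h1' ⊢
    have huv : u * v = u + v := by linear_combination u * h1' - v * h0' - v * h2
    linear_combination huv - (u + v) * hT'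
  have hxy' := congrArg (algebraMap F K) hxy
  simp only [hscale] at hxy'
  exact mul_left_cancel₀ ht0 (hf (mul_left_cancel₀ hT0 hxy'))
end

section
/- Let q = 2^n with n ≥ 5, let a ∈ F_q with a ≠ 0, and let r ∈ F_{q^2} with r ∉ F_q. Define f: F_q → F_{q^2} by f(x) = a·x^2 + 1/(x − r) + 1/(x − r^q). Then the sum over all x ∈ F_q of f(x)^3 equals a·(1 + a·(r + r^q)^3). -/
section PowerSums

variable {F K : Type*} [Field F] [Field K] [Algebra F K]

theorem algebraMap_sub_ne_zero {r : K} (hr : r ∉ Set.range (algebraMap F K)) (x : F) :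
    algebraMap F K x - r ≠ 0 :=
  fun h => hr ⟨x, sub_eq_zero.1 h⟩

variable [Fintype F]

theorem sum_algebraMap_pow_eq_zero {i : ℕ} (hi : i < Fintype.card F - 1) :
    ∑ x : F, algebraMap F K x ^ i = 0 := by
  have h := congrArg (algebraMap F K) (FiniteField.sum_pow_lt_card_sub_one F i hi)
  simpa using h

theorem sum_algebraMap_pow_card_sub_one :
    ∑ x : F, algebraMap F K x ^ (Fintype.card F - 1) = -1 := by
  classical
  have hq : Fintype.card F - 1 ≠ 0 := by
    have := Fintype.one_lt_card (α := F)
    omega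
  have h : ∀ x : F, x ^ (Fintype.card F - 1) = 1 - if x = 0 then 1 else 0 := by
    intro x
    by_cases hx : x = 0
    · simp [hx, hq]
    · simp [hx, FiniteField.pow_card_sub_one_eq_one x hx]
  simp only [← map_pow, ← map_sum]
  rw [Finset.sum_congr rfl fun x _ => h x]
  simp

theorem sum_algebraMap_add_pow (c : K) (m : ℕ) :
    ∑ x : F, (algebraMap F K x + c) ^ m = ∑ i ∈ Finset.range (m + 1),
      (∑ x : F, algebraMap F K x ^ i) * (c ^ (m - i) * (m.choose i : K)) := by
  simp only [add_pow, Finset.sum_mul]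
  rw [Finset.sum_comm]
  simp only [mul_assoc]

theorem sum_algebraMap_sub_pow_eq_zero (r : K) {m : ℕ} (hm : m < Fintype.card F - 1) :
    ∑ x : F, (algebraMap F K x - r) ^ m = 0 := by
  simp only [sub_eq_add_neg, sum_algebraMap_add_pow]
  refine Finset.sum_eq_zero fun i hi => ?_
  rw [Finset.mem_range] at hi
  rw [sum_algebraMap_pow_eq_zero (by omega), zero_mul]

theorem sum_algebraMap_sub_pow_card_sub_one (r : K) :
    ∑ x : F, (algebraMap F K x - r) ^ (Fintype.card F - 1) = -1 := by
  simp only [sub_eq_add_neg, sum_algebraMap_add_pow]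
  rw [Finset.sum_range_succ, Finset.sum_eq_zero, sum_algebraMap_pow_card_sub_one]
  · simp
  · intro i hi
    rw [Finset.mem_range] at hi
    rw [sum_algebraMap_pow_eq_zero hi, zero_mul]

theorem algebraMap_sub_pow_card (r : K) (x : F) :
    (algebraMap F K x - r) ^ Fintype.card F = algebraMap F K x - r ^ Fintype.card F := by
  obtain ⟨p, hp⟩ := CharP.exists F
  obtain ⟨n, hprime, hcard⟩ := FiniteField.card F p
  have : Fact p.Prime := ⟨hprime⟩
  have : CharP K p := charP_of_injective_algebraMap (algebraMap F K).injective p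
  have hx : algebraMap F K x ^ Fintype.card F = algebraMap F K x := by
    rw [← map_pow, FiniteField.pow_card]
  rw [hcard] at hx ⊢
  rw [sub_pow_char_pow, hx]

/-- Powers of `(x - r)⁻¹` are related to each other by `(x - r) ^ q - (x - r) = r - r ^ q`. -/
theorem inv_algebraMap_sub_pow_succ {r : K} (hr : r ∉ Set.range (algebraMap F K)) {k : ℕ}
    (hk : k < Fintype.card F) (x : F) :
    (r ^ Fintype.card F - r) * (algebraMap F K x - r)⁻¹ ^ (k + 1) =
      (algebraMap F K x - r)⁻¹ ^ k - (algebraMap F K x - r) ^ (Fintype.card F - 1 - k) := by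
  have hy := algebraMap_sub_ne_zero hr x
  have hpow := algebraMap_sub_pow_card r x
  have hsplit : (algebraMap F K x - r) ^ Fintype.card F =
      (algebraMap F K x - r) ^ (Fintype.card F - 1 - k) * (algebraMap F K x - r) ^ (k + 1) := by
    rw [← pow_add]
    congr 1
    omega
  rw [inv_pow, inv_pow, ← div_eq_mul_inv, div_eq_iff (pow_ne_zero _ hy), sub_mul, ← hsplit, hpow,
    pow_succ, inv_mul_cancel_left₀ (pow_ne_zero _ hy)]
  ring

theorem sub_mul_sum_inv_algebraMap_sub {r : K} (hr : r ∉ Set.range (algebraMap F K)) :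
    (r ^ Fintype.card F - r) * ∑ x : F, (algebraMap F K x - r)⁻¹ = 1 := by
  have hcard : (Fintype.card F : K) = 0 := by
    rw [← map_natCast (algebraMap F K), FiniteField.cast_card_eq_zero, map_zero]
  have h := fun x : F => inv_algebraMap_sub_pow_succ hr (Fintype.card_pos (α := F)) x
  simp only [zero_add, pow_one, pow_zero, Nat.sub_zero] at h
  rw [Finset.mul_sum, Finset.sum_congr rfl fun x _ => h x, Finset.sum_sub_distrib,
    sum_algebraMap_sub_pow_card_sub_one]
  simp [hcard]

theorem pow_card_sub_ne_zero {r : K} (hr : r ∉ Set.range (algebraMap F K)) :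
    r ^ Fintype.card F - r ≠ 0 :=
  left_ne_zero_of_mul_eq_one (sub_mul_sum_inv_algebraMap_sub hr)

theorem sum_inv_algebraMap_sub_pow {r : K} (hr : r ∉ Set.range (algebraMap F K)) {k : ℕ}
    (hk : k < Fintype.card F) :
    ∑ x : F, (algebraMap F K x - r)⁻¹ ^ (k + 1) = (r ^ Fintype.card F - r)⁻¹ ^ (k + 1) := by
  induction k with
  | zero =>
    simpa using eq_inv_of_mul_eq_one_right (sub_mul_sum_inv_algebraMap_sub hr)
  | succ k ih =>
    have hd := pow_card_sub_ne_zero hr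
    apply mul_left_cancel₀ hd
    rw [Finset.mul_sum, Finset.sum_congr rfl fun x _ => inv_algebraMap_sub_pow_succ hr hk x,
      Finset.sum_sub_distrib, sum_algebraMap_sub_pow_eq_zero r (by omega), ih (by omega),
      sub_zero, pow_succ' _ (k + 1), mul_inv_cancel_left₀ hd]

theorem sum_pow_mul_inv_algebraMap_sub {r : K} (hr : r ∉ Set.range (algebraMap F K)) {j : ℕ}
    (hj : j < Fintype.card F) :
    ∑ x : F, algebraMap F K x ^ j * (algebraMap F K x - r)⁻¹ =
      r ^ j * (r ^ Fintype.card F - r)⁻¹ := by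
  induction j with
  | zero => simpa using sum_inv_algebraMap_sub_pow hr (Fintype.card_pos (α := F))
  | succ j ih =>
    have h : ∀ x : F, algebraMap F K x ^ (j + 1) * (algebraMap F K x - r)⁻¹ =
        algebraMap F K x ^ j + r * (algebraMap F K x ^ j * (algebraMap F K x - r)⁻¹) := by
      intro x
      have hy := algebraMap_sub_ne_zero hr x
      field_simp
      ring
    rw [Finset.sum_congr rfl fun x _ => h x, Finset.sum_add_distrib,
      sum_algebraMap_pow_eq_zero (by omega), ← Finset.mul_sum, ih (by omega)]
    ring

end PowerSums


/-- For `q = 2^n`, `n ≥ 5`, `a ∈ F_q*`, `r ∈ F_{q²} \ F_q`, and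
`f(x) = a·x² + 1/(x - r) + 1/(x - r^q)`,
`∑_{x ∈ F_q} f(x)³ = a·(1 + a·(r + r^q)³)`. -/
theorem stmt_14 (n : ℕ) (hn : 5 ≤ n) (q : ℕ) (hq : q = 2 ^ n)
    (F K : Type*) [Field F] [Fintype F] [Field K] [Fintype K] [Algebra F K]
    (hF : Fintype.card F = q) (hK : Fintype.card K = q ^ 2)
    (a : F) (ha : a ≠ 0)
    (r : K) (hr : r ∉ Set.range (algebraMap F K)) :
    ∑ x : F, (algebraMap F K (a * x ^ 2) + (algebraMap F K x - r)⁻¹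
        + (algebraMap F K x - r ^ q)⁻¹) ^ 3
      = algebraMap F K a * (1 + algebraMap F K a * (r + r ^ q) ^ 3) := by
  have hq32 : 32 ≤ Fintype.card F := by
    rw [hF, hq]
    calc 32 = 2 ^ 5 := by norm_num
      _ ≤ 2 ^ n := Nat.pow_le_pow_right two_pos hn
  have hchar : (2 : F) = 0 := by
    have h := FiniteField.cast_card_eq_zero F
    rw [hF, hq, Nat.cast_pow] at h
    simpa using eq_zero_of_pow_eq_zero h
  have h2 : (2 : K) = 0 := by rw [← map_ofNat (algebraMap F K) 2, hchar, map_zero]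
  have : CharP K 2 := CharTwo.of_one_ne_zero_of_two_eq_zero one_ne_zero h2
  clear hq
  subst hF
  have hrr : (r ^ Fintype.card F) ^ Fintype.card F = r := by
    rw [← pow_mul, ← sq, ← hK, FiniteField.pow_card]
  have hr' : r ^ Fintype.card F ∉ Set.range (algebraMap F K) := by
    rintro ⟨y, hy⟩
    apply hr
    rw [← hrr, ← hy, ← map_pow]
    exact ⟨_, rfl⟩
  have hs := pow_card_sub_ne_zero hr
  have hu (k : ℕ) (hk : k < 5) := sum_inv_algebraMap_sub_pow hr (k := k) (by omega)
  have hv (k : ℕ) (hk : k < 5) := sum_inv_algebraMap_sub_pow hr' (k := k) (by omega)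
  have hxu (j : ℕ) (hj : j < 5) := sum_pow_mul_inv_algebraMap_sub hr (j := j) (by omega)
  have hxv (j : ℕ) (hj : j < 5) := sum_pow_mul_inv_algebraMap_sub hr' (j := j) (by omega)
  rw [hrr] at hv hxv
  have hne := algebraMap_sub_ne_zero hr
  have hne' := algebraMap_sub_ne_zero hr'
  generalize r ^ Fintype.card F = t at *
  simp only [CharTwo.sub_eq_add] at *
  rw [add_comm t r] at *
  have hexpand (x : F) :
      (algebraMap F K (a * x ^ 2) + (algebraMap F K x + r)⁻¹ + (algebraMap F K x + t)⁻¹) ^ 3 =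
        algebraMap F K a ^ 3 * algebraMap F K x ^ 6
        + algebraMap F K a ^ 2 * (algebraMap F K x ^ 4 * (algebraMap F K x + r)⁻¹
          + algebraMap F K x ^ 4 * (algebraMap F K x + t)⁻¹)
        + algebraMap F K a * (algebraMap F K x ^ 1 * (algebraMap F K x + r)⁻¹
          + algebraMap F K x ^ 1 * (algebraMap F K x + t)⁻¹) ^ 2
        + ((algebraMap F K x + r)⁻¹ ^ 3 + (algebraMap F K x + t)⁻¹ ^ 3
          + (r + t)⁻¹ * ((algebraMap F K x + r)⁻¹ ^ 2 + (algebraMap F K x + t)⁻¹ ^ 2)) := by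
    have huv : (algebraMap F K x + r)⁻¹ * (algebraMap F K x + t)⁻¹ =
        (r + t)⁻¹ * ((algebraMap F K x + r)⁻¹ + (algebraMap F K x + t)⁻¹) := by
      have h1 := hne x
      have h3 := hne' x
      field_simp
      linear_combination -algebraMap F K x * h2
    rw [map_mul, map_pow]
    generalize (algebraMap F K x + r)⁻¹ = u at *
    generalize (algebraMap F K x + t)⁻¹ = v at *
    generalize algebraMap F K x = X at *
    generalize algebraMap F K a = A at *
    generalize (r + t)⁻¹ = w at *
    linear_combination (u + v) * huv + (A ^ 2 * X ^ 4 * (u + v) + A * X ^ 2 * (u + v) ^ 2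
      + u ^ 2 * v + u * v ^ 2 + w * u * v) * h2
  simp only [hexpand, Finset.sum_add_distrib, ← Finset.mul_sum, ← CharTwo.sum_sq,
    sum_algebraMap_pow_eq_zero (F := F) (K := K) (show 6 < Fintype.card F - 1 by omega),
    hu 1 (by norm_num), hu 2 (by norm_num), hv 1 (by norm_num), hv 2 (by norm_num),
    hxu 4 (by norm_num), hxu 1 (by norm_num), hxv 4 (by norm_num), hxv 1 (by norm_num)]
  field_simp
  grind
end
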